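/- The supremum of the objective value over all feasible quantile functions G equals max(1/δ, γ*)·x (with the convention that both sides equal +∞ when γ* = +∞). -/

import Mathlib

open MeasureTheory Set Filter Topology ENNReal

noncomputable section

/-- The CDF of a random variable `ρ` under the measure `μ`. -/
def cdfFun {Ω : Type*} [MeasurableSpace Ω] (μ : Measure Ω) (ρ : Ω → ℝ) : ℝ → ℝ :=
  fun t => (μ {ω | ρ ω ≤ t}).toReal

/-- The right-continuous quantile function of `ρ`:
`F_ρ⁻¹(z) = inf {t : F_ρ(t) > z}`. -/
def rcInv {Ω : Type*} [MeasurableSpace Ω] (μ : Measure Ω) (ρ : Ω → ℝ) : ℝ → ℝ :=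
  fun z => sInf {t : ℝ | z < cdfFun μ ρ t}

/-- A feasible quantile function for pricing-density `F = F_ρ⁻¹` and initial wealth `x`:
nondecreasing and right-continuous on `(0,1)`, with `lim_{z↓0} G(z) ≥ 0`, satisfying the
budget constraint `∫_0^1 F(1-z) G(z) dz ≤ x`. -/
def Feasible (F : ℝ → ℝ) (x : ℝ) (G : ℝ → ℝ) : Prop :=
  MonotoneOn G (Set.Ioo 0 1)
  ∧ (∀ z ∈ Set.Ioo (0:ℝ) 1, Filter.Tendsto G (nhdsWithin z (Set.Ioi z)) (nhds (G z)))
  ∧ (∃ L, 0 ≤ L ∧ Filter.Tendsto G (nhdsWithin 0 (Set.Ioi 0)) (nhds L))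
  ∧ ∫⁻ z in Set.Ioo (0:ℝ) 1, ENNReal.ofReal (F (1 - z) * G z) ≤ ENNReal.ofReal x

/-- The extension `Ḡ` of a (nonnegative) quantile function `G` from `(0,1)` to `[0,1]`,
valued in `[0,∞]`, with `Ḡ(0) = lim_{z↓0} G(z)` and `Ḡ(1) = lim_{z↑1} G(z)`
(these limits are the inf/sup over `(0,1)` since `G` is nondecreasing). -/
def Gbar (G : ℝ → ℝ) : ℝ → ℝ≥0∞ := fun z =>
  if z = 0 then ⨅ y ∈ Set.Ioo (0:ℝ) 1, ENNReal.ofReal (G y)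
  else if z = 1 then ⨆ y ∈ Set.Ioo (0:ℝ) 1, ENNReal.ofReal (G y)
  else ENNReal.ofReal (G z)

/-- The objective value `∫_{[0,1]} Ḡ(z) m(dz)` of a quantile function `G`
(for `m` a Borel probability measure carried by `[0,1]`). -/
def objVal (m : Measure ℝ) (G : ℝ → ℝ) : ℝ≥0∞ := ∫⁻ z, Gbar G z ∂m

/-- `ζ(c) = m([c,1]) / ∫_c^1 F(1-z) dz`. -/
def zeta (F : ℝ → ℝ) (m : Measure ℝ) (c : ℝ) : ℝ :=
  (m (Set.Icc c 1)).toReal / ∫ z in c..1, F (1 - z)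

theorem lintegral_le_lintegral_meas_ofReal_lt {α : Type*} [MeasurableSpace α] {m : Measure α}
    {f : α → ℝ≥0∞} (hf : AEMeasurable f m) :
    ∫⁻ z, f z ∂m ≤ ∫⁻ t in Ioi (0:ℝ), m {z | ENNReal.ofReal t < f z} := by
  have hsup : ∀ z, f z = ⨆ n : ℕ, min (f z) n := fun z => by
    rw [← inf_iSup_eq, ENNReal.iSup_natCast, inf_top_eq]
  have hmeas : ∀ n : ℕ, AEMeasurable (fun z => min (f z) n) m := fun n =>
    hf.min aemeasurable_const
  have hfin : ∀ (n : ℕ) z, min (f z) n ≠ ∞ := fun n z =>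
    ((min_le_right _ _).trans_lt (ENNReal.natCast_lt_top n)).ne
  rw [lintegral_congr hsup, lintegral_iSup' hmeas]
  · refine iSup_le fun n => ?_
    rw [← lintegral_congr fun z => ENNReal.ofReal_toReal (hfin n z),
      lintegral_eq_lintegral_meas_lt m (Eventually.of_forall fun _ => ENNReal.toReal_nonneg)
        (hmeas n).ennreal_toReal]
    refine setLIntegral_mono' measurableSet_Ioi fun t ht => measure_mono fun z hz => ?_
    exact ((ENNReal.ofReal_lt_iff_lt_toReal (le_of_lt ht) (hfin n z)).2 hz).trans_le (min_le_left _ _)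
  · exact Eventually.of_forall fun z i j hij => min_le_min_left _ (by exact_mod_cast hij)

/-- The measure on `(0,1)` with density `z ↦ F (1 - z)`. -/
def pricingMeasure (F : ℝ → ℝ) : Measure ℝ :=
  (volume.restrict (Ioo 0 1)).withDensity fun z => ENNReal.ofReal (F (1 - z))

section Pricing

variable {F : ℝ → ℝ}

theorem aemeasurable_pricing_density
    (hint : IntervalIntegrable (fun z => F (1 - z)) volume 0 1) :
    AEMeasurable (fun z => F (1 - z)) (volume.restrict (Ioo 0 1)) :=
  (((intervalIntegrable_iff_integrableOn_Ioo_of_le zero_le_one).1 hint).aestronglyMeasurable).aemeasurable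

theorem intervalIntegrable_pricing_tail
    (hint : IntervalIntegrable (fun z => F (1 - z)) volume 0 1) {c : ℝ} (hc : c ∈ Ico (0:ℝ) 1) :
    IntervalIntegrable (fun z => F (1 - z)) volume c 1 :=
  hint.mono_set (by
    rw [uIcc_of_le hc.2.le, uIcc_of_le zero_le_one]
    exact Icc_subset_Icc_left hc.1)

theorem integral_pricing_tail_pos (hpos : ∀ z ∈ Ioo (0:ℝ) 1, 0 < F z)
    (hint : IntervalIntegrable (fun z => F (1 - z)) volume 0 1) {c : ℝ} (hc : c ∈ Ico (0:ℝ) 1) :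
    0 < ∫ z in c..1, F (1 - z) :=
  intervalIntegral.intervalIntegral_pos_of_pos_on (intervalIntegrable_pricing_tail hint hc)
    (fun z hz => hpos _ ⟨by linarith [hz.2], by linarith [hz.1, hc.1]⟩) hc.2

theorem pricingMeasure_Ioo (hpos : ∀ z ∈ Ioo (0:ℝ) 1, 0 < F z)
    (hint : IntervalIntegrable (fun z => F (1 - z)) volume 0 1) {c : ℝ} (hc : c ∈ Ico (0:ℝ) 1) :
    pricingMeasure F (Ioo c 1) = ENNReal.ofReal (∫ z in c..1, F (1 - z)) := by
  rw [pricingMeasure, withDensity_apply _ measurableSet_Ioo,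
    Measure.restrict_restrict measurableSet_Ioo,
    inter_eq_left.2 (Ioo_subset_Ioo_left hc.1),
    intervalIntegral.integral_of_le hc.2.le, integral_Ioc_eq_integral_Ioo,
    ofReal_integral_eq_lintegral_ofReal]
  · exact (intervalIntegrable_iff_integrableOn_Ioo_of_le hc.2.le).1
      (intervalIntegrable_pricing_tail hint hc)
  · filter_upwards [ae_restrict_mem measurableSet_Ioo] with z hz
    exact (hpos _ ⟨by linarith [hz.2], by linarith [hz.1, hc.1]⟩).le

theorem lintegral_pricingMeasure (hpos : ∀ z ∈ Ioo (0:ℝ) 1, 0 < F z)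
    (hint : IntervalIntegrable (fun z => F (1 - z)) volume 0 1) {G : ℝ → ℝ}
    (hG : AEMeasurable G (volume.restrict (Ioo 0 1))) :
    ∫⁻ z, ENNReal.ofReal (G z) ∂pricingMeasure F
      = ∫⁻ z in Ioo (0:ℝ) 1, ENNReal.ofReal (F (1 - z) * G z) := by
  rw [pricingMeasure, lintegral_withDensity_eq_lintegral_mul₀
    (aemeasurable_pricing_density hint).ennreal_ofReal hG.ennreal_ofReal]
  refine lintegral_congr_ae ?_
  filter_upwards [ae_restrict_mem measurableSet_Ioo] with z hz
  rw [Pi.mul_apply,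
    ENNReal.ofReal_mul (hpos _ ⟨by linarith [hz.2], by linarith [hz.1]⟩).le]

end Pricing

theorem monotoneOn_Gbar {G : ℝ → ℝ} (hG : MonotoneOn G (Ioo 0 1)) :
    MonotoneOn (Gbar G) (Icc 0 1) := by
  intro a ha b hb hab
  rcases hab.eq_or_lt with rfl | hab
  · exact le_rfl
  have ha1 : a ≠ 1 := (hab.trans_le hb.2).ne
  have hb0 : b ≠ 0 := (ha.1.trans_lt hab).ne'
  simp only [Gbar, if_neg ha1, if_neg hb0]
  split_ifs with h0 h1 h1
  · exact (iInf₂_le (1/2 : ℝ) (by norm_num)).trans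
      (le_iSup₂ (f := fun y (_ : y ∈ Ioo (0:ℝ) 1) => ENNReal.ofReal (G y)) (1/2 : ℝ) (by norm_num))
  · exact iInf₂_le b ⟨lt_of_le_of_ne hb.1 (Ne.symm hb0), lt_of_le_of_ne hb.2 h1⟩
  · exact le_iSup₂ (f := fun y (_ : y ∈ Ioo (0:ℝ) 1) => ENNReal.ofReal (G y)) a
      ⟨lt_of_le_of_ne ha.1 (Ne.symm h0), lt_of_le_of_ne ha.2 ha1⟩
  · have ha' : 0 < a := lt_of_le_of_ne ha.1 (Ne.symm h0)
    have hb' : b < 1 := lt_of_le_of_ne hb.2 h1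
    exact ENNReal.ofReal_le_ofReal (hG ⟨ha', hab.trans hb'⟩ ⟨ha'.trans hab, hb'⟩ hab.le)

theorem exists_lt_of_lt_Gbar {G : ℝ → ℝ} (hG : MonotoneOn G (Ioo 0 1)) {t : ℝ≥0∞} {z : ℝ}
    (hz : z ∈ Icc (0:ℝ) 1) (h : t < Gbar G z) :
    ∃ y ∈ Ioo (0:ℝ) 1, t < ENNReal.ofReal (G y) := by
  have h1 : t < Gbar G 1 := h.trans_le (monotoneOn_Gbar hG hz ⟨zero_le_one, le_rfl⟩ hz.2)
  simp only [Gbar, if_neg one_ne_zero, if_true] at h1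
  obtain ⟨y, hy⟩ := lt_iSup_iff.1 h1
  obtain ⟨hy, hty⟩ := lt_iSup_iff.1 hy
  exact ⟨y, hy, hty⟩

theorem Feasible.nonneg {F G : ℝ → ℝ} {x : ℝ} (h : Feasible F x G) {z : ℝ}
    (hz : z ∈ Ioo (0:ℝ) 1) : 0 ≤ G z := by
  obtain ⟨hmono, -, ⟨L, hL, hlim⟩, -⟩ := h
  refine hL.trans (le_of_tendsto hlim ?_)
  filter_upwards [Ioo_mem_nhdsGT hz.1] with y hy
  exact hmono ⟨hy.1, hy.2.trans hz.2⟩ hz hy.2.le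

section Bound

variable {F : ℝ → ℝ} {m : Measure ℝ} [IsProbabilityMeasure m]

theorem meas_lt_Gbar_le (hpos : ∀ z ∈ Ioo (0:ℝ) 1, 0 < F z)
    (hint : IntervalIntegrable (fun z => F (1 - z)) volume 0 1)
    (hm : m (Icc (0:ℝ) 1)ᶜ = 0) {C : ℝ≥0∞}
    (hC0 : ENNReal.ofReal (1 / ∫ z in (0:ℝ)..1, F (1 - z)) ≤ C)
    (hC : ∀ c ∈ Ioo (0:ℝ) 1, ENNReal.ofReal (zeta F m c) ≤ C)
    {G : ℝ → ℝ} (hG : MonotoneOn G (Ioo 0 1)) {t : ℝ} (ht : 0 ≤ t) :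
    m {z | ENNReal.ofReal t < Gbar G z} ≤ C * pricingMeasure F {z | t < G z} := by
  set S := {y | y ∈ Ioo (0:ℝ) 1 ∧ t < G y}
  have hae : ∀ A : Set ℝ, m A = m (A ∩ Icc 0 1) := fun A =>
    (measure_inter_conull hm).symm
  rw [hae]
  rcases S.eq_empty_or_nonempty with hSe | hSne
  · refine le_trans (le_of_eq ?_) zero_le
    rw [show {z | ENNReal.ofReal t < Gbar G z} ∩ Icc 0 1 = ∅ from ?_, measure_empty]
    refine eq_empty_of_forall_notMem fun z hz => ?_
    obtain ⟨y, hy, hty⟩ := exists_lt_of_lt_Gbar hG hz.2 hz.1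
    refine (hSe ▸ notMem_empty y : y ∉ S) ⟨hy, (ENNReal.ofReal_lt_ofReal_iff_of_nonneg ht).1 hty⟩
  have hbdd : BddBelow S := ⟨0, fun y hy => hy.1.1.le⟩
  obtain ⟨y₀, hy₀⟩ := hSne
  have hc : sInf S ∈ Ico (0:ℝ) 1 :=
    ⟨le_csInf ⟨y₀, hy₀⟩ fun y hy => hy.1.1.le, (csInf_le hbdd hy₀).trans_lt hy₀.1.2⟩
  have hsub : Ioo (sInf S) 1 ⊆ {z | t < G z} := fun z hz => by
    obtain ⟨y, hy, hyz⟩ := (csInf_lt_iff hbdd ⟨y₀, hy₀⟩).1 hz.1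
    exact hy.2.trans_le (hG hy.1 ⟨hc.1.trans_lt hz.1, hz.2⟩ hyz.le)
  refine le_trans ?_ (mul_le_mul_right (measure_mono hsub) C)
  have hI := integral_pricing_tail_pos hpos hint hc
  rw [pricingMeasure_Ioo hpos hint hc]
  rcases hc.1.eq_or_lt with h0 | h0
  · rw [← h0] at hI ⊢
    refine le_trans ?_ (mul_le_mul_left hC0 _)
    rw [← ENNReal.ofReal_mul (by positivity), one_div_mul_cancel hI.ne', ENNReal.ofReal_one]
    exact prob_le_one
  · refine le_trans ?_ (mul_le_mul_left (hC _ ⟨h0, hc.2⟩) _)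
    rw [zeta, ← ENNReal.ofReal_mul (by positivity), div_mul_cancel₀ _ hI.ne',
      ENNReal.ofReal_toReal (measure_ne_top _ _)]
    refine measure_mono fun z hz => ⟨?_, hz.2.2⟩
    by_contra! hzc
    have hz1 : z < 1 := hzc.trans hc.2
    obtain ⟨y, hzy, hyc⟩ := exists_between hzc
    have hy : y ∈ Ioo (0:ℝ) 1 := ⟨hz.2.1.trans_lt hzy, hyc.trans hc.2⟩
    have hlt : ENNReal.ofReal t < Gbar G y :=
      lt_of_lt_of_le hz.1 (monotoneOn_Gbar hG hz.2 (Ioo_subset_Icc_self hy) hzy.le)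
    simp only [Gbar, if_neg hy.1.ne', if_neg hy.2.ne] at hlt
    exact absurd (csInf_le hbdd ⟨hy, (ENNReal.ofReal_lt_ofReal_iff_of_nonneg ht).1 hlt⟩)
      (not_le.2 hyc)

theorem Feasible.objVal_le (hpos : ∀ z ∈ Ioo (0:ℝ) 1, 0 < F z)
    (hint : IntervalIntegrable (fun z => F (1 - z)) volume 0 1)
    (hm : m (Icc (0:ℝ) 1)ᶜ = 0) {C : ℝ≥0∞}
    (hC0 : ENNReal.ofReal (1 / ∫ z in (0:ℝ)..1, F (1 - z)) ≤ C)
    (hC : ∀ c ∈ Ioo (0:ℝ) 1, ENNReal.ofReal (zeta F m c) ≤ C)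
    (hCtop : C ≠ ∞) {x : ℝ} {G : ℝ → ℝ} (h : Feasible F x G) :
    objVal m G ≤ C * ENNReal.ofReal x := by
  have hGm : AEMeasurable G (volume.restrict (Ioo 0 1)) :=
    aemeasurable_restrict_of_monotoneOn measurableSet_Ioo h.1
  have hac : pricingMeasure F ≪ volume.restrict (Ioo 0 1) := withDensity_absolutelyContinuous _ _
  have hbar : AEMeasurable (Gbar G) m := by
    rw [← Measure.restrict_eq_self_of_ae_mem (s := Icc (0:ℝ) 1) (μ := m) hm]
    exact aemeasurable_restrict_of_monotoneOn measurableSet_Icc (monotoneOn_Gbar h.1)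
  have hnn : 0 ≤ᵐ[pricingMeasure F] G := hac.ae_le <| by
    filter_upwards [ae_restrict_mem measurableSet_Ioo] with z hz using h.nonneg hz
  calc objVal m G
      ≤ ∫⁻ t in Ioi (0:ℝ), m {z | ENNReal.ofReal t < Gbar G z} :=
        lintegral_le_lintegral_meas_ofReal_lt hbar
    _ ≤ ∫⁻ t in Ioi (0:ℝ), C * pricingMeasure F {z | t < G z} :=
        setLIntegral_mono' measurableSet_Ioi fun t ht =>
          meas_lt_Gbar_le hpos hint hm hC0 hC h.1 (le_of_lt ht)
    _ = C * ∫⁻ z, ENNReal.ofReal (G z) ∂pricingMeasure F := by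
        rw [lintegral_const_mul' _ _ hCtop,
          lintegral_eq_lintegral_meas_lt _ hnn (hGm.mono_ac hac)]
    _ ≤ C * ENNReal.ofReal x := by
        rw [lintegral_pricingMeasure hpos hint hGm]
        exact mul_le_mul_right h.2.2.2 C

end Bound

section Attainment

variable {F : ℝ → ℝ}

theorem feasible_const (hpos : ∀ z ∈ Ioo (0:ℝ) 1, 0 < F z)
    (hint : IntervalIntegrable (fun z => F (1 - z)) volume 0 1) {x : ℝ} (hx : 0 < x) :
    Feasible F x fun _ => x / ∫ z in (0:ℝ)..1, F (1 - z) := by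
  have h01 : (0:ℝ) ∈ Ico (0:ℝ) 1 := by simp
  have hI := integral_pricing_tail_pos hpos hint h01
  refine ⟨monotoneOn_const, fun _ _ => tendsto_const_nhds,
    ⟨_, (div_pos hx hI).le, tendsto_const_nhds⟩, ?_⟩
  rw [← lintegral_pricingMeasure hpos hint aemeasurable_const, lintegral_const]
  have huniv : pricingMeasure F univ = pricingMeasure F (Ioo 0 1) := by
    simp [pricingMeasure, withDensity_apply]
  rw [huniv, pricingMeasure_Ioo hpos hint h01, ← ENNReal.ofReal_mul (by positivity),
    div_mul_cancel₀ _ hI.ne']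

theorem feasible_indicator_Ici (hpos : ∀ z ∈ Ioo (0:ℝ) 1, 0 < F z)
    (hint : IntervalIntegrable (fun z => F (1 - z)) volume 0 1) {x : ℝ} (hx : 0 < x)
    {c : ℝ} (hc : c ∈ Ioo (0:ℝ) 1) :
    Feasible F x ((Ici c).indicator fun _ => x / ∫ z in c..1, F (1 - z)) := by
  have hc' : c ∈ Ico (0:ℝ) 1 := Ioo_subset_Ico_self hc
  have hI := integral_pricing_tail_pos hpos hint hc'
  have hk : 0 < x / ∫ z in c..1, F (1 - z) := div_pos hx hI
  set k := x / ∫ z in c..1, F (1 - z)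
  refine ⟨fun a _ b _ hab => ?_, fun z _ => ?_, ⟨0, le_rfl, ?_⟩, ?_⟩
  · by_cases ha : c ≤ a
    · simp [indicator, ha, ha.trans hab]
    · rw [indicator_of_notMem (by simpa using ha)]
      exact indicator_nonneg (fun _ _ => hk.le) _
  · refine tendsto_const_nhds.congr' ?_
    by_cases hz : c ≤ z
    · filter_upwards [self_mem_nhdsWithin] with y hy
      simp [indicator, hz, hz.trans (le_of_lt hy)]
    · filter_upwards [Ioo_mem_nhdsGT (not_le.1 hz)] with y hy
      simp [indicator, hz, hy.2]
  · refine tendsto_const_nhds.congr' ?_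
    filter_upwards [Ioo_mem_nhdsGT hc.1] with y hy
    simp [indicator, hy.2]
  · rw [← lintegral_pricingMeasure hpos hint
      (aemeasurable_const.indicator measurableSet_Ici)]
    have hind : ∀ z, ENNReal.ofReal ((Ici c).indicator (fun _ => k) z)
        = (Ici c).indicator (fun _ => ENNReal.ofReal k) z := fun z => by
      by_cases hz : c ≤ z <;> simp [indicator, hz]
    have hIci : pricingMeasure F (Ici c) = pricingMeasure F (Ioo c 1) := by
      have h1 : Ici c ∩ Ioo (0:ℝ) 1 = Ico c 1 := by
        ext z
        simp only [mem_inter_iff, mem_Ici, mem_Ioo, mem_Ico]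
        exact ⟨fun h => ⟨h.1, h.2.2⟩, fun h => ⟨h.1, hc.1.trans_le h.1, h.2⟩⟩
      rw [pricingMeasure, withDensity_apply _ measurableSet_Ici,
        withDensity_apply _ measurableSet_Ioo, Measure.restrict_restrict measurableSet_Ici,
        Measure.restrict_restrict measurableSet_Ioo, h1,
        inter_eq_left.2 (Ioo_subset_Ioo_left hc.1.le), Measure.restrict_congr_set Ioo_ae_eq_Ico]
    rw [lintegral_congr hind, lintegral_indicator_const measurableSet_Ici, hIci,
      pricingMeasure_Ioo hpos hint hc', ← ENNReal.ofReal_mul hk.le, div_mul_cancel₀ _ hI.ne']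

variable {m : Measure ℝ}

theorem ofReal_le_objVal_const [IsProbabilityMeasure m] (k : ℝ) : ENNReal.ofReal k ≤ objVal m fun _ => k := by
  have hne : (Ioo (0:ℝ) 1).Nonempty := ⟨1 / 2, by norm_num⟩
  have hbar : Gbar (fun _ => k) = fun _ => ENNReal.ofReal k := by
    ext z
    simp only [Gbar, biInf_const hne, biSup_const hne, ite_self]
  simp [objVal, hbar]

theorem ofReal_mul_meas_Icc_le_objVal_indicator {c : ℝ} (hc : c ∈ Ioo (0:ℝ) 1) (k : ℝ) :
    ENNReal.ofReal k * m (Icc c 1) ≤ objVal m ((Ici c).indicator fun _ => k) := by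
  rw [objVal, ← lintegral_indicator_const measurableSet_Icc]
  refine lintegral_mono fun z => indicator_le (fun z hz => ?_) z
  have hz0 : z ≠ 0 := (hc.1.trans_le hz.1).ne'
  simp only [Gbar, if_neg hz0]
  split_ifs with h1
  · refine le_iSup₂_of_le c hc ?_
    simp
  · rw [indicator_of_mem (mem_Ici.2 hz.1)]

end Attainment

theorem rcInv_pos {Ω : Type*} [MeasurableSpace Ω] (μ : Measure Ω) [IsProbabilityMeasure μ]
    {ρ : Ω → ℝ} (hρmeas : Measurable ρ) (hρpos : ∀ ω, 0 < ρ ω)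
    (hcdf : Continuous (cdfFun μ ρ)) {z : ℝ} (hz : z ∈ Ioo (0:ℝ) 1) : 0 < rcInv μ ρ z := by
  have hmono : Monotone (cdfFun μ ρ) := fun s t hst =>
    ENNReal.toReal_mono (measure_ne_top _ _) (measure_mono fun ω hω => le_trans hω hst)
  have hprob : IsProbabilityMeasure (μ.map ρ) :=
    Measure.isProbabilityMeasure_map hρmeas.aemeasurable
  have heq : cdfFun μ ρ = ProbabilityTheory.cdf (μ.map ρ) := by
    ext t
    rw [ProbabilityTheory.cdf_eq_real, measureReal_def, Measure.map_apply hρmeas measurableSet_Iic]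
    rfl
  have hzero : cdfFun μ ρ 0 = 0 := by
    have : {ω | ρ ω ≤ 0} = ∅ := by
      ext ω
      simpa using hρpos ω
    simp [cdfFun, this]
  have htop : Tendsto (cdfFun μ ρ) atTop (𝓝 1) := heq ▸ ProbabilityTheory.tendsto_cdf_atTop _
  have hne : {t | z < cdfFun μ ρ t}.Nonempty := (htop.eventually_const_lt hz.2).exists
  have hsmall : ∀ᶠ t in 𝓝 0, cdfFun μ ρ t < z :=
    hcdf.continuousAt.eventually_lt_const (by rw [hzero]; exact hz.1)
  obtain ⟨ε, hεz, hε⟩ :=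
    ((hsmall.filter_mono nhdsWithin_le_nhds).and (self_mem_nhdsWithin (s := Ioi (0:ℝ)))).exists
  refine lt_of_lt_of_le hε (le_csInf hne fun t ht => ?_)
  exact (hmono.reflect_lt (hεz.trans ht)).le

/-- the supremum of the objective value over all feasible quantile
functions equals `max(1/δ, γ*)·x` (in `[0,∞]`; both sides are `+∞` when `γ* = +∞`). -/
theorem iSup_objVal_eq_max
    {Ω : Type*} [MeasurableSpace Ω] (μ : Measure Ω) [IsProbabilityMeasure μ]
    (ρ : Ω → ℝ) (hρmeas : Measurable ρ) (hρpos : ∀ ω, 0 < ρ ω)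
    (hρint : Integrable ρ μ) (hcdf : Continuous (cdfFun μ ρ))
    (m : Measure ℝ) [IsProbabilityMeasure m] (hm : m (Set.Icc (0:ℝ) 1)ᶜ = 0)
    (x δ : ℝ) (hx : 0 < x) (hδpos : 0 < δ)
    (hδ1 : δ = ∫ ω, ρ ω ∂μ) (hδ2 : δ = ∫ z in (0:ℝ)..1, rcInv μ ρ (1 - z)) :
    (⨆ (G : ℝ → ℝ) (_ : Feasible (rcInv μ ρ) x G), objVal m G)
      = max (ENNReal.ofReal (1 / δ))
          (⨆ c ∈ Set.Ioo (0:ℝ) 1, ENNReal.ofReal (zeta (rcInv μ ρ) m c)) * ENNReal.ofReal x := by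
  have hpos : ∀ z ∈ Ioo (0:ℝ) 1, 0 < rcInv μ ρ z := fun z hz =>
    rcInv_pos μ hρmeas hρpos hcdf hz
  have hint : IntervalIntegrable (fun z => rcInv μ ρ (1 - z)) volume 0 1 := by
    by_contra h
    rw [intervalIntegral.integral_undef h] at hδ2
    exact hδpos.ne' hδ2
  apply le_antisymm
  · refine iSup₂_le fun G hG => ?_
    by_cases htop : max (ENNReal.ofReal (1 / δ))
        (⨆ c ∈ Set.Ioo (0:ℝ) 1, ENNReal.ofReal (zeta (rcInv μ ρ) m c)) = ∞
    · rw [htop, ENNReal.top_mul (ENNReal.ofReal_pos.2 hx).ne']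
      exact le_top
    · exact hG.objVal_le hpos hint hm (hδ2 ▸ le_max_left _ _)
        (fun c hc => (le_iSup₂ (f := fun c (_ : c ∈ Set.Ioo (0:ℝ) 1) =>
          ENNReal.ofReal (zeta (rcInv μ ρ) m c)) c hc).trans (le_max_right _ _)) htop
  · rw [max_mul_of_nonneg _ _ zero_le, ENNReal.iSup_mul]
    refine max_le ?_ (iSup_le fun c => ?_)
    · refine le_iSup₂_of_le _ (feasible_const hpos hint hx) ?_
      rw [← hδ2, ← ENNReal.ofReal_mul (by positivity), one_div_mul_eq_div]
      exact ofReal_le_objVal_const _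
    · rw [ENNReal.iSup_mul]
      refine iSup_le fun hc => le_iSup₂_of_le _ (feasible_indicator_Ici hpos hint hx hc) ?_
      refine le_trans (le_of_eq ?_) (ofReal_mul_meas_Icc_le_objVal_indicator hc _)
      have hI := integral_pricing_tail_pos hpos hint (Ioo_subset_Ico_self hc)
      rw [← ENNReal.ofReal_toReal (measure_ne_top m (Icc c 1)), zeta,
        ← ENNReal.ofReal_mul (by positivity), ← ENNReal.ofReal_mul (by positivity)]
      congr 1
      ring
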